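/- arXiv:1112.0358 — 2 statements merged into one kernel-verified Lean document; each statement's English description precedes it below -/
import Mathlib

section
/- Let k ≥ 3 and let r be an integer with 1 ≤ r ≤ k−1. There exists p₀ depending only on k such that for every prime p ≥ p₀ and all integers a, b with 1 ≤ a < b, one has B_{a,b}^{r,k}(p) ≤ k!·p^{r(r−1)(a+b)/2}. -/
open scoped BigOperators

/-- `Ξ_c^r(ξ)`: the set of `r`-tuples `(ξ₁,…,ξ_r)` of integers with
`1 ≤ ξᵢ ≤ p^{c+1}`, `ξᵢ ≡ ξ (mod p^c)` for each `i`, and `ξᵢ ≡ ξⱼ (mod p^{c+1})`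
for no `i ≠ j`. -/
def XiSet (p c r : ℕ) (ξ : ℤ) : Set (Fin r → ℤ) :=
  {ξ' | (∀ i, 1 ≤ ξ' i ∧ ξ' i ≤ (p : ℤ) ^ (c + 1) ∧ ((p : ℤ) ^ c) ∣ (ξ' i - ξ)) ∧
    ∀ i j : Fin r, i ≠ j → ¬ ((p : ℤ) ^ (c + 1) ∣ (ξ' i - ξ' j))}

/-- The solution set `B_{a,b}^{σ,r}(m;ξ,η)` (for `a ≥ 1`): `r`-tuples `z` with
`1 ≤ zᵢ ≤ p^{kb}`, satisfying `∑ᵢ σᵢ(zᵢ-η)^j ≡ m_j (mod p^{jb})` for `1 ≤ j ≤ k`,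
and `z ≡ ξ' (mod p^{a+1})` for some `ξ' ∈ Ξ_a^r(ξ)`. -/
def Bset (p k r a b : ℕ) (σ : Fin r → ℤ) (m : ℕ → ℤ) (ξ η : ℤ) : Set (Fin r → ℤ) :=
  {z | (∀ i, 1 ≤ z i ∧ z i ≤ (p : ℤ) ^ (k * b)) ∧
    (∀ j ∈ Finset.Icc 1 k, ((p : ℤ) ^ (j * b)) ∣ ((∑ i, σ i * (z i - η) ^ j) - m j)) ∧
    ∃ ξ' ∈ XiSet p a r ξ, ∀ i, ((p : ℤ) ^ (a + 1)) ∣ (z i - ξ' i)}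

/-- The variant `B_{0,b}^{σ,r}(m;0,η)`: additionally `zᵢ ≢ η (mod p)` for each `i`,
and the congruence class condition is modulo `p` with `ξ' ∈ Ξ_0^r(0)`. -/
def Bset0 (p k r b : ℕ) (σ : Fin r → ℤ) (m : ℕ → ℤ) (η : ℤ) : Set (Fin r → ℤ) :=
  {z | (∀ i, 1 ≤ z i ∧ z i ≤ (p : ℤ) ^ (k * b)) ∧
    (∀ j ∈ Finset.Icc 1 k, ((p : ℤ) ^ (j * b)) ∣ ((∑ i, σ i * (z i - η) ^ j) - m j)) ∧
    (∀ i, ¬ ((p : ℤ) ∣ (z i - η))) ∧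
    ∃ ξ' ∈ XiSet p 0 r 0, ∀ i, ((p : ℤ)) ∣ (z i - ξ' i)}

/-- The number of equivalence classes of a set of `r`-tuples of integers under
coordinatewise congruence modulo `n`. -/
noncomputable def numClasses (n r : ℕ) (S : Set (Fin r → ℤ)) : ℕ :=
  Set.ncard ((fun z : Fin r → ℤ => fun i => ((z i : ZMod n))) '' S)

section Helpers
open Polynomial

lemma refine_card {α : Type*} {r : ℕ} (A : Finset α) (f : Fin r → α → ℤ) (M Q : Fin r → ℕ)
    (hM : ∀ l, 0 < M l) (hQ : ∀ l, 0 < Q l) (h : ∀ z ∈ A, ∀ z' ∈ A, ∀ l, (M l : ℤ) ∣ f l z - f l z') (c : ℕ)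
    (hc : ∀ A' ⊆ A, (∀ z ∈ A', ∀ z' ∈ A', ∀ l, ((M l * Q l : ℕ) : ℤ) ∣ f l z - f l z') → A'.card ≤ c) :
    A.card ≤ c * ∏ l, Q l := by
  classical
  rcases A.eq_empty_or_nonempty with rfl | ⟨z0, hz0⟩
  · simp
  have : ∀ l, NeZero (Q l) := fun l => ⟨(hQ l).ne'⟩
  let Φ : α → (∀ l, ZMod (Q l)) := fun z l => (((f l z - f l z0) / (M l) : ℤ) : ZMod (Q l))
  have h1 := Finset.card_le_mul_card_image (f := Φ) A c (by
    intro b hb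
    apply hc _ (Finset.filter_subset _ _)
    intro z hz z' hz' l
    rw [Finset.mem_filter] at hz hz'
    have e : Φ z l = Φ z' l := by rw [hz.2, hz'.2]
    obtain ⟨s, hs⟩ := h z hz.1 z0 hz0 l
    obtain ⟨t, ht⟩ := h z' hz'.1 z0 hz0 l
    have hMl : (M l : ℤ) ≠ 0 := by exact_mod_cast (hM l).ne'
    simp only [Φ, hs, ht, Int.mul_ediv_cancel_left _ hMl] at e
    rw [ZMod.intCast_eq_intCast_iff_dvd_sub] at e
    obtain ⟨w, hw⟩ := e
    refine ⟨-w, ?_⟩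
    have : f l z - f l z' = M l * (s - t) := by linear_combination hs - ht
    rw [this, show s - t = - (Q l * w) by linear_combination -hw]
    push_cast; ring)
  refine h1.trans (Nat.mul_le_mul_left _ ?_)
  refine (Finset.card_le_univ _).trans ?_
  simp [Fintype.card_pi, ZMod.card]

lemma newton_mem {F : Type*} [Field F] (r : ℕ) (hch : ∀ n : ℕ, 1 ≤ n → n ≤ r → (n : F) ≠ 0)
    (x x' : Fin r → F) (h : ∀ l, 1 ≤ l → l ≤ r → ∑ i, x i ^ l = ∑ i, x' i ^ l) (i : Fin r) :
    ∃ j, x i = x' j := by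
  have hE : ∀ n ≤ r, MvPolynomial.aeval x (MvPolynomial.esymm (Fin r) F n)
      = MvPolynomial.aeval x' (MvPolynomial.esymm (Fin r) F n) := by
    intro n
    induction n using Nat.strong_induction_on with
    | _ n ih =>
      intro hn
      rcases Nat.eq_zero_or_pos n with rfl | hpos
      · simp
      have a1 := congrArg (MvPolynomial.aeval x) (MvPolynomial.mul_esymm_eq_sum (Fin r) F n)
      have a2 := congrArg (MvPolynomial.aeval x') (MvPolynomial.mul_esymm_eq_sum (Fin r) F n)
      have : (n : F) * MvPolynomial.aeval x (MvPolynomial.esymm (Fin r) F n)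
          = (n : F) * MvPolynomial.aeval x' (MvPolynomial.esymm (Fin r) F n) := by
        simp only [map_mul, map_natCast, map_sum, map_pow, map_neg, map_one, MvPolynomial.psum,
          MvPolynomial.aeval_X] at a1 a2
        rw [a1, a2]
        congr 1
        apply Finset.sum_congr rfl
        intro q hq
        rw [Finset.mem_filter, Finset.HasAntidiagonal.mem_antidiagonal] at hq
        rw [ih q.1 hq.2 (by omega), h q.2 (by omega) (by omega)]
      exact mul_left_cancel₀ (hch n hpos hn) this
  have hP : ∏ j, (X - C (x j)) = ∏ j, (X - C (x' j)) := by
    have key : ∀ y : Fin r → F, ∏ j, (X - C (y j)) = ∑ j ∈ Finset.range (r + 1),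
        (-1) ^ j * (C (MvPolynomial.aeval y (MvPolynomial.esymm (Fin r) F j)) * X ^ (r - j)) := by
      intro y
      have := Multiset.prod_X_sub_X_eq_sum_esymm (Multiset.map y Finset.univ.val)
      simp only [Multiset.map_map, Multiset.card_map] at this
      simpa [MvPolynomial.aeval_esymm_eq_multiset_esymm, Finset.prod] using this
    rw [key, key]
    apply Finset.sum_congr rfl
    intro j hj
    rw [hE j (by simpa [Nat.lt_succ_iff] using hj)]
  have := congrArg (eval (x i)) hP
  simp only [eval_prod, eval_sub, eval_X, eval_C] at this
  rw [Finset.prod_eq_zero (Finset.mem_univ i) (sub_self _)] at this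
  obtain ⟨j, -, hj⟩ := Finset.prod_eq_zero_iff.1 this.symm
  exact ⟨j, sub_eq_zero.1 hj⟩

lemma signed_mem {F : Type*} [Field F] (r : ℕ) (hch : ∀ n : ℕ, 1 ≤ n → n ≤ r → (n : F) ≠ 0)
    (σ : Fin r → ℤ) (hσ : ∀ i, σ i = 1 ∨ σ i = -1)
    (y y' : Fin r → F) (hy : Function.Injective y)
    (h : ∀ l, 1 ≤ l → l ≤ r → ∑ i, (σ i : F) * y i ^ l = ∑ i, (σ i : F) * y' i ^ l) (i : Fin r) :
    ∃ j, y i = y' j := by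
  let x : Fin r → F := fun i => if σ i = 1 then y i else y' i
  let x' : Fin r → F := fun i => if σ i = 1 then y' i else y i
  have hs : ∀ l, 1 ≤ l → l ≤ r → ∑ i, x i ^ l = ∑ i, x' i ^ l := by
    intro l h1 h2
    have := h l h1 h2
    rw [← sub_eq_zero, ← Finset.sum_sub_distrib] at this ⊢
    rw [← this]
    apply Finset.sum_congr rfl
    intro i _
    rcases hσ i with e | e <;> (simp [x, x', e]; try ring)
  rcases hσ i with e | e
  · obtain ⟨j, hj⟩ := newton_mem r hch x x' hs i
    rcases hσ j with e' | e' <;> norm_num [x, x', e, e'] at hj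
    · exact ⟨j, hj⟩
    · rw [hy hj] at e; omega
  · obtain ⟨j, hj⟩ := newton_mem r hch x' x (fun l h1 h2 => (hs l h1 h2).symm) i
    rcases hσ j with e' | e' <;> norm_num [x, x', e, e'] at hj
    · rw [hy hj] at e; omega
    · exact ⟨j, hj⟩

noncomputable def antider (k : ℕ) (f : ℤ[X]) : ℤ[X] :=
  ∑ j ∈ Finset.range k, C (f.coeff j * ((k.factorial / (j + 1) : ℕ) : ℤ)) * X ^ (j + 1)

lemma derivative_antider (k : ℕ) (f : ℤ[X]) (hf : f.natDegree < k) :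
    derivative (antider k f) = C (k.factorial : ℤ) * f := by
  conv_rhs => rw [f.as_sum_range' k hf, Finset.mul_sum]
  rw [antider, derivative_sum]
  apply Finset.sum_congr rfl
  intro j hj
  rw [derivative_C_mul_X_pow, C_mul_monomial, ← C_mul_X_pow_eq_monomial]
  have : ((k.factorial / (j + 1) : ℕ) : ℤ) * ((j + 1 : ℕ) : ℤ) = k.factorial := by
    rw [← Nat.cast_mul, Nat.div_mul_cancel]
    exact Nat.dvd_factorial (by omega) (by simpa using hj)
  rw [mul_assoc, this, mul_comm (f.coeff j)]; simp

lemma eval_antider (k : ℕ) (f : ℤ[X]) (x : ℤ) :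
    (antider k f).eval x = ∑ j ∈ Finset.range k, f.coeff j * ((k.factorial / (j + 1) : ℕ) : ℤ) * x ^ (j + 1) := by
  simp [antider, eval_finsetSum]

noncomputable def f1 (k r l : ℕ) (u : ℤ) : ℤ[X] := X ^ (k - r) * (X - C u) ^ l
noncomputable def f2 (k r l : ℕ) (u P : ℤ) : ℤ[X] := (C u + C P * X) ^ (k - r) * X ^ l

lemma deg1 (k r l : ℕ) (u : ℤ) (hr : r ≤ k) (hl : l < r) : (f1 k r l u).natDegree < k := by
  have : (f1 k r l u).natDegree ≤ (k - r) * 1 + l * 1 := by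
    unfold f1
    refine natDegree_mul_le_of_le (natDegree_pow_le_of_le _ ?_) (natDegree_pow_le_of_le _ ?_)
    · simp
    · exact natDegree_X_sub_C_le u
  omega

lemma deg2 (k r l : ℕ) (u P : ℤ) (hr : r ≤ k) (hl : l < r) : (f2 k r l u P).natDegree < k := by
  have : (f2 k r l u P).natDegree ≤ (k - r) * 1 + l * 1 := by
    unfold f2
    refine natDegree_mul_le_of_le (natDegree_pow_le_of_le _ ?_) (natDegree_pow_le_of_le _ (by simp))
    compute_degree
  omega

lemma comp_eq (k r l : ℕ) (u P : ℤ) (hr : r ≤ k) (hl : l < r) (y y' : ℤ) :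
    (antider k (f1 k r l u)).eval (u + P * y) - (antider k (f1 k r l u)).eval (u + P * y')
      = P ^ (l + 1) * ((antider k (f2 k r l u P)).eval y - (antider k (f2 k r l u P)).eval y') := by
  set G : ℤ[X] := (antider k (f1 k r l u)).comp (C u + C P * X) - C (P ^ (l + 1)) * antider k (f2 k r l u P) with hG
  have hd : derivative G = 0 := by
    rw [hG, derivative_sub, derivative_comp, derivative_C_mul, derivative_antider _ _ (deg1 k r l u hr hl),
      derivative_antider _ _ (deg2 k r l u P hr hl)]
    simp [f1, f2]
    ring
  have h0 := derivative_eq_zero.1 hd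
  rw [natDegree_eq_zero] at h0
  obtain ⟨c, hc⟩ := h0
  have e1 := congrArg (eval y) hc
  have e2 := congrArg (eval y') hc
  simp [hG, eval_comp] at e1 e2
  linear_combination e2 - e1

/-- The reduction of `antider f2` modulo `p`. -/
lemma eval2_mod (p : ℕ) [Fact p.Prime] (k r l : ℕ) (u P : ℤ) (hP : (p : ℤ) ∣ P) (hr : r ≤ k) (hl : l < r) (y : ℤ) :
    (((antider k (f2 k r l u P)).eval y : ℤ) : ZMod p)
      = (u : ZMod p) ^ (k - r) * ((k.factorial / (l + 1) : ℕ) : ZMod p) * (y : ZMod p) ^ (l + 1) := by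
  have hP0 : (P : ZMod p) = 0 := (ZMod.intCast_zmod_eq_zero_iff_dvd _ _).2 hP
  have hc : ∀ j, (((f2 k r l u P).coeff j : ℤ) : ZMod p) = if j = l then (u : ZMod p) ^ (k - r) else 0 := by
    intro j
    have : (((f2 k r l u P).coeff j : ℤ) : ZMod p) = ((f2 k r l u P).map (Int.castRingHom (ZMod p))).coeff j := by
      simp [coeff_map]
    rw [this]
    have e : (f2 k r l u P).map (Int.castRingHom (ZMod p)) = C ((u : ZMod p) ^ (k - r)) * X ^ l := by
      simp only [f2, Polynomial.map_mul, Polynomial.map_pow, Polynomial.map_add, map_C, map_X]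
      simp only [Int.coe_castRingHom, hP0, C_0, zero_mul, add_zero, C_pow]
    rw [e, coeff_C_mul, coeff_X_pow]; simp
  rw [eval_antider]
  rw [Int.cast_sum, Finset.sum_eq_single l]
  · rw [Int.cast_mul, Int.cast_mul, hc, if_pos rfl, Int.cast_natCast, Int.cast_pow]
  · intro j _ hj; rw [Int.cast_mul, Int.cast_mul, hc, if_neg hj]; simp
  · intro hh; simp at hh; omega

lemma deriv2_mod (p : ℕ) [Fact p.Prime] (k r l : ℕ) (u P : ℤ) (hP : (p : ℤ) ∣ P) (hr : r ≤ k) (hl : l < r) (y : ℤ) :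
    (((derivative (antider k (f2 k r l u P))).eval y : ℤ) : ZMod p)
      = (k.factorial : ZMod p) * (u : ZMod p) ^ (k - r) * (y : ZMod p) ^ l := by
  have hP0 : (P : ZMod p) = 0 := (ZMod.intCast_zmod_eq_zero_iff_dvd _ _).2 hP
  rw [derivative_antider _ _ (deg2 k r l u P hr hl)]
  simp [f2, hP0, mul_assoc]

/-- difference quotient -/
lemma diffquot (p : ℕ) (f : ℤ[X]) (y y' : ℤ) (h : (p : ℤ) ∣ y' - y) :
    ∃ q : ℤ, f.eval y' - f.eval y = q * (y' - y) ∧ (q : ZMod p) = ((derivative f).eval y : ℤ) := by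
  obtain ⟨c, hc⟩ := f.binomExpansion y (y' - y)
  rw [add_sub_cancel] at hc
  refine ⟨(derivative f).eval y + c * (y' - y), by rw [hc]; ring, ?_⟩
  have : ((y' - y : ℤ) : ZMod p) = 0 := (ZMod.intCast_zmod_eq_zero_iff_dvd _ _).2 h
  rw [Int.cast_add, Int.cast_mul, this]; simp

lemma hensel (p : ℕ) [Fact p.Prime] (k r : ℕ) (hkp : k < p) (hr : r ≤ k) (u P : ℤ) (hP : (p : ℤ) ∣ P)
    (hu : ¬ (p : ℤ) ∣ u) (σ : Fin r → ℤ) (hσ : ∀ i, σ i = 1 ∨ σ i = -1) (n : ℕ)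
    (y y' : Fin r → ℤ) (hy : ∀ i j, i ≠ j → ¬ (p : ℤ) ∣ y i - y j) (hyy : ∀ i, (p : ℤ) ∣ y' i - y i)
    (h : ∀ l : Fin r, (p : ℤ) ^ n ∣ ∑ i, σ i * (antider k (f2 k r l u P)).eval (y' i)
      - ∑ i, σ i * (antider k (f2 k r l u P)).eval (y i)) (i : Fin r) :
    (p : ℤ) ^ n ∣ y' i - y i := by
  choose q hq1 hq2 using fun (l i : Fin r) => diffquot p (antider k (f2 k r l u P)) (y i) (y' i) (hyy i)
  let M : Matrix (Fin r) (Fin r) ℤ := Matrix.of fun l i => q l i * σ i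
  let d : Fin r → ℤ := fun i => y' i - y i
  have hMd : ∀ l, (p : ℤ) ^ n ∣ M.mulVec d l := by
    intro l
    convert h l using 1
    rw [← Finset.sum_sub_distrib]
    simp only [Matrix.mulVec, dotProduct]
    apply Finset.sum_congr rfl
    intro i _
    simp only [M, d, Matrix.of_apply]
    linear_combination -σ i * hq1 l i
  have hdet : (M.det : ZMod p) ≠ 0 := by
    have e1 : (M.det : ZMod p) = (M.map (Int.castRingHom (ZMod p))).det := by
      exact RingHom.map_det (Int.castRingHom (ZMod p)) M
    have e2 : M.map (Int.castRingHom (ZMod p)) =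
        Matrix.of fun l i => ((k.factorial : ZMod p) * (u : ZMod p) ^ (k - r) * (σ i : ZMod p)) *
          (Matrix.vandermonde (fun i => (y i : ZMod p))).transpose l i := by
      ext l i
      simp only [M, Matrix.map_apply, Matrix.of_apply, Matrix.transpose_apply, Matrix.vandermonde_apply, eq_intCast,
        Int.cast_mul, hq2, deriv2_mod p k r l u P hP hr l.2]
      ring
    rw [e1, e2, Matrix.det_mul_row, Matrix.det_transpose]
    refine mul_ne_zero (Finset.prod_ne_zero_iff.2 fun i _ => mul_ne_zero (mul_ne_zero ?_ (pow_ne_zero _ ?_)) ?_)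
      (Matrix.det_vandermonde_ne_zero_iff.2 ?_)
    · rw [Ne, ZMod.natCast_eq_zero_iff, (Fact.out : p.Prime).dvd_factorial]; omega
    · rwa [Ne, ZMod.intCast_zmod_eq_zero_iff_dvd]
    · rcases hσ i with e | e <;> simp [e]
    · intro i j hij
      by_contra hne
      apply hy i j hne
      rw [← ZMod.intCast_zmod_eq_zero_iff_dvd, Int.cast_sub, sub_eq_zero]; exact hij
  have hfin : (p : ℤ) ^ n ∣ M.det * d i := by
    have : M.det * d i = (M.adjugate.mulVec (M.mulVec d)) i := by
      rw [Matrix.mulVec_mulVec, Matrix.adjugate_mul]; simp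
    rw [this]
    simp only [Matrix.mulVec, dotProduct] at hMd ⊢
    exact Finset.dvd_sum fun j _ => Dvd.dvd.mul_left (hMd j) _
  refine IsCoprime.dvd_of_dvd_mul_left (IsCoprime.pow_left ?_) hfin
  rw [(Nat.prime_iff_prime_int.1 Fact.out).coprime_iff_not_dvd, ← ZMod.intCast_zmod_eq_zero_iff_dvd]
  exact hdet

lemma perm_mod (p : ℕ) [Fact p.Prime] (k r : ℕ) (hkp : k < p) (hr : r ≤ k) (u P : ℤ) (hP : (p : ℤ) ∣ P)
    (hu : ¬ (p : ℤ) ∣ u) (σ : Fin r → ℤ) (hσ : ∀ i, σ i = 1 ∨ σ i = -1)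
    (y y' : Fin r → ℤ) (hy : ∀ i j, i ≠ j → ¬ (p : ℤ) ∣ y i - y j)
    (h : ∀ l : Fin r, (p : ℤ) ∣ ∑ i, σ i * (antider k (f2 k r l u P)).eval (y i)
      - ∑ i, σ i * (antider k (f2 k r l u P)).eval (y' i)) (i : Fin r) :
    ∃ j, (p : ℤ) ∣ y i - y' j := by
  have hch : ∀ n : ℕ, 1 ≤ n → n ≤ k → (n : ZMod p) ≠ 0 := by
    intro n h1 h2
    rw [Ne, ZMod.natCast_eq_zero_iff]
    intro hh; have := Nat.le_of_dvd h1 hh; omega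
  obtain ⟨j, hj⟩ := signed_mem (F := ZMod p) r (fun n h1 h2 => hch n h1 (h2.trans hr)) σ hσ
    (fun i => (y i : ZMod p)) (fun i => (y' i : ZMod p)) (by
      intro i j hij
      by_contra hne
      apply hy i j hne
      rw [← ZMod.intCast_zmod_eq_zero_iff_dvd, Int.cast_sub, sub_eq_zero]; exact hij) (by
      intro l h1 h2
      have := h ⟨l - 1, by omega⟩
      rw [← ZMod.intCast_zmod_eq_zero_iff_dvd, Int.cast_sub, sub_eq_zero, Int.cast_sum, Int.cast_sum] at this
      simp only [Int.cast_mul, eval2_mod p k r (l - 1) u P hP hr (by omega), Nat.sub_add_cancel h1] at this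
      have hne : (u : ZMod p) ^ (k - r) * ((k.factorial / l : ℕ) : ZMod p) ≠ 0 := by
        refine mul_ne_zero (pow_ne_zero _ ?_) ?_
        · rwa [Ne, ZMod.intCast_zmod_eq_zero_iff_dvd]
        · rw [Ne, ZMod.natCast_eq_zero_iff]
          intro hh
          have := hh.trans (Nat.div_dvd_of_dvd (Nat.dvd_factorial h1 (h2.trans hr)))
          rw [(Fact.out : p.Prime).dvd_factorial] at this; omega
      apply mul_left_cancel₀ hne
      rw [Finset.mul_sum, Finset.mul_sum]
      convert this using 2 <;> ring) i
  refine ⟨j, ?_⟩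
  rw [← ZMod.intCast_zmod_eq_zero_iff_dvd, Int.cast_sub, sub_eq_zero]; exact hj

lemma final_count (p : ℕ) [Fact p.Prime] (k r : ℕ) (hkp : k < p) (hr : r ≤ k) (u P : ℤ) (hP : (p : ℤ) ∣ P)
    (hu : ¬ (p : ℤ) ∣ u) (σ : Fin r → ℤ) (hσ : ∀ i, σ i = 1 ∨ σ i = -1) (n : ℕ) (hn : n ≠ 0)
    (A : Finset (Fin r → ℤ)) (Y : (Fin r → ℤ) → Fin r → ℤ)
    (hY : ∀ z ∈ A, ∀ i j, i ≠ j → ¬ (p : ℤ) ∣ Y z i - Y z j)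
    (hinj : ∀ z ∈ A, ∀ z' ∈ A, (∀ i, (p : ℤ) ^ n ∣ Y z i - Y z' i) → z = z')
    (h : ∀ z ∈ A, ∀ z' ∈ A, ∀ l : Fin r, (p : ℤ) ^ n ∣
      ∑ i, σ i * (antider k (f2 k r l u P)).eval (Y z i)
      - ∑ i, σ i * (antider k (f2 k r l u P)).eval (Y z' i)) :
    A.card ≤ r.factorial := by
  classical
  rcases A.eq_empty_or_nonempty with rfl | ⟨z0, hz0⟩
  · simp
  have key : ∀ z : A, ∀ i, ∃ j, (p : ℤ) ∣ Y z i - Y z0 j := fun z i =>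
    perm_mod p k r hkp hr u P hP hu σ hσ (Y z) (Y z0) (hY z z.2)
      (fun l => (dvd_pow_self _ hn).trans (h z z.2 z0 hz0 l)) i
  choose g hg using key
  have ginj : ∀ z, Function.Injective (g z) := by
    intro z i j hij
    by_contra hne
    apply hY z z.2 i j hne
    have := dvd_sub (hg z i) (hg z j)
    rw [hij] at this
    simpa using this
  let G : A → (Fin r ↪ Fin r) := fun z => ⟨g z, ginj z⟩
  have hG : Function.Injective G := by
    intro z z' hzz
    have hzz' : g z = g z' := congrArg (fun e : Fin r ↪ Fin r => (e : Fin r → Fin r)) hzz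
    apply Subtype.ext
    apply hinj z z.2 z' z'.2
    apply hensel p k r hkp hr u P hP hu σ hσ n (Y z') (Y z) (hY z' z'.2)
    · intro i
      have := dvd_sub (hg z i) (hg z' i)
      rw [hzz'] at this
      simpa using this
    · exact h z z.2 z' z'.2
  have := Fintype.card_le_of_injective G hG
  simpa [Fintype.card_embedding_eq, Nat.descFactorial_self] using this

lemma step_two (p : ℕ) [Fact p.Prime] (k r a b : ℕ) (hkp : k < p) (hr : r < k) (ha : 1 ≤ a) (hab : a < b)
    (ξ η : ℤ) (hu : ¬ (p : ℤ) ∣ ξ - η) (σ : Fin r → ℤ) (hσ : ∀ i, σ i = 1 ∨ σ i = -1)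
    (A : Finset (Fin r → ℤ))
    (hA1 : ∀ z ∈ A, ∀ i, 1 ≤ z i ∧ z i ≤ (p : ℤ) ^ (k * b))
    (hA2 : ∀ z ∈ A, ∀ i, (p : ℤ) ^ a ∣ z i - ξ)
    (hA3 : ∀ z ∈ A, ∀ i j, i ≠ j → ¬ (p : ℤ) ^ (a + 1) ∣ z i - z j)
    (h : ∀ z ∈ A, ∀ z' ∈ A, ∀ j, k - r + 1 ≤ j → j ≤ k →
      (p : ℤ) ^ (k * b) ∣ ∑ i, σ i * (z i - η) ^ j - ∑ i, σ i * (z' i - η) ^ j) :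
    A.card ≤ r.factorial * ∏ l : Fin r, p ^ ((l : ℕ) * a) := by
  have hp : p.Prime := Fact.out
  have hp0 : (p : ℤ) ≠ 0 := by exact_mod_cast hp.ne_zero
  let Y : (Fin r → ℤ) → Fin r → ℤ := fun z i => (z i - ξ) / (p : ℤ) ^ a
  have hYz : ∀ z ∈ A, ∀ i, z i = ξ + (p : ℤ) ^ a * Y z i := by
    intro z hz i
    have := Int.mul_ediv_cancel' (hA2 z hz i)
    simp only [Y]; linarith
  have hle : ∀ l, l ≤ r → l * a ≤ k * b := fun l hl => Nat.mul_le_mul (by omega) hab.le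
  have hlt : a < k * b := by nlinarith
  refine refine_card A (fun l z => ∑ i, σ i * (antider k (f2 k r l (ξ - η) ((p : ℤ) ^ a))).eval (Y z i))
    (fun l => p ^ (k * b - ((l : ℕ) + 1) * a)) (fun l => p ^ ((l : ℕ) * a))
    (fun l => pow_pos hp.pos _) (fun l => pow_pos hp.pos _) ?_ _ ?_
  · intro z hz z' hz' l
    have e : ∑ i, σ i * (antider k (f1 k r l (ξ - η))).eval (z i - η)
        - ∑ i, σ i * (antider k (f1 k r l (ξ - η))).eval (z' i - η)
        = ((p : ℤ) ^ a) ^ ((l : ℕ) + 1) *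
          (∑ i, σ i * (antider k (f2 k r l (ξ - η) ((p : ℤ) ^ a))).eval (Y z i)
          - ∑ i, σ i * (antider k (f2 k r l (ξ - η) ((p : ℤ) ^ a))).eval (Y z' i)) := by
      rw [← Finset.sum_sub_distrib, ← Finset.sum_sub_distrib, Finset.mul_sum]
      apply Finset.sum_congr rfl
      intro i _
      have := comp_eq k r l (ξ - η) ((p : ℤ) ^ a) hr.le l.2 (Y z i) (Y z' i)
      rw [show ξ - η + (p : ℤ) ^ a * Y z i = z i - η by rw [hYz z hz i]; ring,
        show ξ - η + (p : ℤ) ^ a * Y z' i = z' i - η by rw [hYz z' hz' i]; ring] at this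
      linear_combination σ i * this
    have d : (p : ℤ) ^ (k * b) ∣ ∑ i, σ i * (antider k (f1 k r l (ξ - η))).eval (z i - η)
        - ∑ i, σ i * (antider k (f1 k r l (ξ - η))).eval (z' i - η) := by
      have sw : ∀ w : Fin r → ℤ, ∑ i, σ i * (antider k (f1 k r l (ξ - η))).eval (w i - η)
          = ∑ j ∈ Finset.range k, (f1 k r l (ξ - η)).coeff j * ((k.factorial / (j + 1) : ℕ) : ℤ) *
            ∑ i, σ i * (w i - η) ^ (j + 1) := by
        intro w
        simp only [eval_antider, Finset.mul_sum]
        rw [Finset.sum_comm]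
        refine Finset.sum_congr rfl fun j _ => Finset.sum_congr rfl fun i _ => by ring
      rw [sw, sw, ← Finset.sum_sub_distrib]
      apply Finset.dvd_sum
      intro j hj
      rw [Finset.mem_range] at hj
      rw [← mul_sub]
      by_cases hjr : k - r ≤ j
      · exact Dvd.dvd.mul_left (h z hz z' hz' (j + 1) (by omega) (by omega)) _
      · have : (f1 k r l (ξ - η)).coeff j = 0 := by
          rw [f1, coeff_X_pow_mul', if_neg hjr]
        simp [this]
    rw [e, ← pow_mul] at d
    have hsplit : k * b = a * ((l : ℕ) + 1) + (k * b - ((l : ℕ) + 1) * a) := by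
      have := hle ((l : ℕ) + 1) (by omega)
      rw [mul_comm a]; omega
    rw [hsplit, pow_add] at d
    push_cast
    exact (mul_dvd_mul_iff_left (pow_ne_zero _ hp0)).1 d
  · intro A' hA' hcong
    refine final_count p k r hkp hr.le (ξ - η) ((p : ℤ) ^ a) (dvd_pow_self _ (by omega)) hu σ hσ
      (k * b - a) (by omega) A' Y ?_ ?_ ?_
    · intro z hz i j hij hd
      apply hA3 z (hA' hz) i j hij
      rw [hYz z (hA' hz) i, hYz z (hA' hz) j, pow_succ]
      obtain ⟨c, hc⟩ := hd
      exact ⟨c, by linear_combination (p : ℤ) ^ a * hc⟩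
    · intro z hz z' hz' hd
      funext i
      have e1 := mul_dvd_mul_left ((p : ℤ) ^ a) (hd i)
      rw [← pow_add, show a + (k * b - a) = k * b by omega,
        show (p : ℤ) ^ a * (Y z i - Y z' i) = z i - z' i by
          rw [hYz z (hA' hz) i, hYz z' (hA' hz') i]; ring] at e1
      have b1 := hA1 z (hA' hz) i
      have b2 := hA1 z' (hA' hz') i
      have := Int.eq_zero_of_abs_lt_dvd e1 (by rw [abs_lt]; constructor <;> linarith)
      linarith
    · intro z hz z' hz' l
      have := hcong z hz z' hz' l
      rw [← pow_add, show k * b - ((l : ℕ) + 1) * a + (l : ℕ) * a = k * b - a by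
        have := hle ((l : ℕ) + 1) (by omega)
        rw [add_mul] at this ⊢; omega] at this
      exact_mod_cast this

lemma step_one (p : ℕ) [Fact p.Prime] (k r a b : ℕ) (hkp : k < p) (hr : r < k) (ha : 1 ≤ a) (hab : a < b)
    (ξ η : ℤ) (hu : ¬ (p : ℤ) ∣ ξ - η) (σ : Fin r → ℤ) (hσ : ∀ i, σ i = 1 ∨ σ i = -1)
    (A : Finset (Fin r → ℤ)) (m : ℕ → ℤ)
    (hA1 : ∀ z ∈ A, ∀ i, 1 ≤ z i ∧ z i ≤ (p : ℤ) ^ (k * b))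
    (hA2 : ∀ z ∈ A, ∀ i, (p : ℤ) ^ a ∣ z i - ξ)
    (hA3 : ∀ z ∈ A, ∀ i j, i ≠ j → ¬ (p : ℤ) ^ (a + 1) ∣ z i - z j)
    (h : ∀ z ∈ A, ∀ j, 1 ≤ j → j ≤ k →
      (p : ℤ) ^ (j * b) ∣ ∑ i, σ i * (z i - η) ^ j - m j) :
    A.card ≤ (r.factorial * ∏ l : Fin r, p ^ ((l : ℕ) * a)) * ∏ l : Fin r, p ^ ((l : ℕ) * b) := by
  have hp : p.Prime := Fact.out
  refine refine_card A (fun l z => ∑ i, σ i * (z i - η) ^ (k - (l : ℕ)))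
    (fun l => p ^ ((k - (l : ℕ)) * b)) (fun l => p ^ ((l : ℕ) * b))
    (fun l => pow_pos hp.pos _) (fun l => pow_pos hp.pos _) ?_ _ ?_
  · intro z hz z' hz' l
    have := dvd_sub (h z hz (k - (l : ℕ)) (by omega) (by omega)) (h z' hz' (k - (l : ℕ)) (by omega) (by omega))
    push_cast
    simpa using this
  · intro A' hA' hcong
    refine step_two p k r a b hkp hr ha hab ξ η hu σ hσ A' (fun z hz => hA1 z (hA' hz))
      (fun z hz => hA2 z (hA' hz)) (fun z hz => hA3 z (hA' hz)) ?_
    intro z hz z' hz' j h1 h2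
    have := hcong z hz z' hz' ⟨k - j, by omega⟩
    simp only [← pow_add, ← add_mul] at this
    rw [show k - (k - j) = j by omega, show j + (k - j) = k by omega] at this
    exact_mod_cast this

lemma expo (p r a b : ℕ) : (∏ l : Fin r, p ^ ((l : ℕ) * a)) * ∏ l : Fin r, p ^ ((l : ℕ) * b)
    = p ^ (r * (r - 1) * (a + b) / 2) := by
  rw [← Finset.prod_mul_distrib]
  simp only [← pow_add, ← mul_add]
  rw [Finset.prod_pow_eq_pow_sum, ← Finset.sum_mul, Fin.sum_univ_eq_sum_range (fun i => i) r]
  congr 1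
  rw [← Finset.sum_range_id_mul_two, mul_right_comm, Nat.mul_div_cancel _ (by norm_num)]

end Helpers

theorem statement9 (k r : ℕ) (hk : 3 ≤ k) (hr1 : 1 ≤ r) (hr2 : r ≤ k - 1) :
    ∃ p₀ : ℕ, ∀ p : ℕ, p.Prime → p₀ ≤ p →
      ∀ a b : ℕ, 1 ≤ a → a < b →
      ∀ ξ η : ℤ, 1 ≤ ξ → ξ ≤ (p : ℤ) ^ a → 1 ≤ η → η ≤ (p : ℤ) ^ b →
        ¬ ((p : ℤ) ∣ (η - ξ)) →
      ∀ σ : Fin r → ℤ, (∀ i, σ i = 1 ∨ σ i = -1) →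
      ∀ m : ℕ → ℤ, (∀ j ∈ Finset.Icc 1 k, 1 ≤ m j ∧ m j ≤ (p : ℤ) ^ (k * b)) →
      numClasses (p ^ (k * b)) r (Bset p k r a b σ m ξ η) ≤
        k.factorial * p ^ (r * (r - 1) * (a + b) / 2) := by
  refine ⟨k + 1, fun p hp hpk a b ha hab ξ η _ _ _ _ hne σ hσ m _ => ?_⟩
  have : Fact p.Prime := ⟨hp⟩
  have hfin : (Bset p k r a b σ m ξ η).Finite := by
    apply Set.Finite.subset (Set.Finite.pi' (fun _ : Fin r => Set.finite_Icc (1 : ℤ) ((p : ℤ) ^ (k * b))))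
    intro z hz i
    exact hz.1 i
  unfold numClasses
  refine (Set.ncard_image_le hfin).trans ?_
  rw [Set.ncard_eq_toFinset_card _ hfin]
  have main := step_one p k r a b (by omega) (by omega) ha hab ξ η
    (fun hd => hne (by rw [← neg_sub]; exact (dvd_neg).2 hd)) σ hσ hfin.toFinset m
    (fun z hz => ((hfin.mem_toFinset).1 hz).1)
    (fun z hz i => by
      obtain ⟨_, _, ξ', hξ, hz'⟩ := (hfin.mem_toFinset).1 hz
      have h1 := (pow_dvd_pow (p : ℤ) (Nat.le_succ a)).trans (hz' i)
      have h2 := dvd_add h1 (hξ.1 i).2.2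
      simpa using h2)
    (fun z hz i j hij hd => by
      obtain ⟨_, _, ξ', hξ, hz'⟩ := (hfin.mem_toFinset).1 hz
      apply hξ.2 i j hij
      obtain ⟨c, hc⟩ := dvd_add (dvd_sub hd (hz' i)) (hz' j)
      exact ⟨c, by linear_combination hc⟩)
    (fun z hz j h1 h2 => ((hfin.mem_toFinset).1 hz).2.1 j (Finset.mem_Icc.2 ⟨h1, h2⟩))
  rw [mul_assoc, expo] at main
  exact main.trans (Nat.mul_le_mul_right _ (Nat.factorial_le (by omega)))
end

section
/- Let k ≥ 3, let r be an integer with 1 ≤ r ≤ k−1, and set ρ = k−r+1. There exists p₀ depending only on k such that for every prime p ≥ p₀ and all natural numbers a, b with a < b and b ≥ (r−1)a, one has B_{a,b}^{r,ρ}(p) ≤ k!·p^{(r−1)a}. -/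
open scoped BigOperators

namespace Stmt11
open Polynomial Finset

/-- `k!` times the formal antiderivative (for polynomials of degree `< k`). -/
noncomputable def anti {R : Type*} [CommRing R] (k : ℕ) (g : R[X]) : R[X] :=
  ∑ n ∈ range k, C (g.coeff n * ((k.factorial / (n + 1) : ℕ) : R)) * X ^ (n + 1)

lemma anti_derivative {R : Type*} [CommRing R] (k : ℕ) (g : R[X]) (hg : g.natDegree < k) :
    derivative (anti k g) = C ((k.factorial : ℕ) : R) * g := by
  conv_rhs => rw [g.as_sum_range_C_mul_X_pow' hg]
  rw [anti, derivative_sum, mul_sum]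
  refine sum_congr rfl fun n hn => ?_
  have hd : (n + 1) ∣ k.factorial := Nat.dvd_factorial (by omega) (by simpa using hn)
  have h2 : (((k.factorial / (n + 1) : ℕ) : R)) * ((n : R) + 1) = (k.factorial : R) := by
    have := Nat.div_mul_cancel hd
    exact_mod_cast congrArg (Nat.cast : ℕ → R) this
  rw [derivative_C_mul_X_pow, ← mul_assoc, ← C_mul]
  congr 2
  push_cast
  rw [mul_assoc, h2, mul_comm]

lemma anti_eval {R : Type*} [CommRing R] (k : ℕ) (g : R[X]) (u : R) :
    (anti k g).eval u = ∑ n ∈ range k, (g.coeff n * ((k.factorial / (n + 1) : ℕ) : R)) * u ^ (n + 1) := by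
  simp [anti, eval_finsetSum]

lemma anti_map {R S : Type*} [CommRing R] [CommRing S] (f : R →+* S) (k : ℕ) (g : R[X]) :
    (anti k g).map f = anti k (g.map f) := by
  simp [anti, Polynomial.map_sum]

lemma anti_monomial {R : Type*} [CommRing R] (k : ℕ) (e : R) (l : ℕ) (hl : l < k) (u : R) :
    (anti k (C e * X ^ l)).eval u = e * ((k.factorial / (l + 1) : ℕ) : R) * u ^ (l + 1) := by
  rw [anti_eval, sum_eq_single l]
  · simp
  · intro n _ hn
    simp [coeff_X_pow, hn]
  · intro h; simp at h; omega

/-- The polynomial integrand. -/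
noncomputable def integrand (c q : ℤ) (d l : ℕ) : ℤ[X] := (C c + C q * X) ^ d * X ^ l

lemma lin_deg (c q : ℤ) : (C c + C q * X : ℤ[X]).natDegree ≤ 1 := by
  compute_degree

lemma integrand_deg (c q : ℤ) (d l : ℕ) : (integrand c q d l).natDegree ≤ d + l := by
  unfold integrand
  refine natDegree_mul_le.trans ?_
  have h1 := natDegree_pow_le_of_le d (lin_deg c q)
  have h2 : (X ^ l : ℤ[X]).natDegree ≤ l := by simp
  omega

lemma key_identity (c q : ℤ) (d l k : ℕ) (h : d + l < k) (y : ℤ) :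
    (anti k (X ^ d * (X - C c) ^ l)).eval (c + q * y) - (anti k (X ^ d * (X - C c) ^ l)).eval c
      = q ^ (l + 1) * (anti k (integrand c q d l)).eval y := by
  set Q := anti k (X ^ d * (X - C c) ^ l) with hQ
  set H := anti k (integrand c q d l) with hH
  set L : ℤ[X] := C c + C q * X with hL
  have hQd : derivative Q = C ((k.factorial : ℕ) : ℤ) * (X ^ d * (X - C c) ^ l) := by
    apply anti_derivative
    refine lt_of_le_of_lt natDegree_mul_le ?_
    have h2 : ((X - C c) ^ l : ℤ[X]).natDegree ≤ l := by
      have := natDegree_pow_le_of_le l (natDegree_X_sub_C_le c)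
      simpa using this
    have h1 : (X ^ d : ℤ[X]).natDegree ≤ d := by simp
    omega
  have hHd : derivative H = C ((k.factorial : ℕ) : ℤ) * integrand c q d l :=
    anti_derivative _ _ (lt_of_le_of_lt (integrand_deg c q d l) h)
  have hz : derivative (Q.comp L - C (q ^ (l + 1)) * H) = 0 := by
    rw [derivative_sub, derivative_comp, derivative_C_mul, hQd, hHd]
    have : derivative L = C q := by simp [hL]
    rw [this]
    simp only [mul_comp, pow_comp, sub_comp, X_comp, C_comp, integrand, ← hL]
    have : L - C c = C q * X := by simp [hL]
    rw [this, C_pow]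
    ring
  have hc := eq_C_of_natDegree_eq_zero (derivative_eq_zero.1 hz)
  have e1 := congrArg (eval y) hc
  have e0 := congrArg (eval 0) hc
  have hH0 : H.eval 0 = 0 := by simp [hH, anti_eval]
  simp only [eval_sub, eval_comp, eval_mul, eval_C, hH0, hL, eval_add, eval_X, mul_zero, add_zero, sub_zero] at e0 e1
  rw [← e0] at e1
  linarith

lemma lemE (p a M d r k : ℕ) (hp : p.Prime) (hk : k = d + r) (c : ℤ) (σ y y' : Fin r → ℤ)
    (hyp : ∀ j ∈ Finset.Icc (d + 1) k, ((p : ℤ) ^ (M + r * a)) ∣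
      ∑ i, σ i * (c + (p : ℤ) ^ a * y i) ^ j - ∑ i, σ i * (c + (p : ℤ) ^ a * y' i) ^ j)
    (l : ℕ) (hl : l < r) :
    ((p : ℤ) ^ M) ∣ ∑ i, σ i * ((anti k (integrand c ((p : ℤ) ^ a) d l)).eval (y i)
      - (anti k (integrand c ((p : ℤ) ^ a) d l)).eval (y' i)) := by
  set H := anti k (integrand c ((p : ℤ) ^ a) d l) with hH
  set q : ℤ := (p : ℤ) ^ a with hq
  have hp0 : (p : ℤ) ≠ 0 := by exact_mod_cast hp.ne_zero
  have key := key_identity c q d l k (by omega)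
  set g : ℤ[X] := X ^ d * (X - C c) ^ l with hg
  have h1 : ((p : ℤ) ^ (M + r * a)) ∣ ∑ i, σ i * ((anti k g).eval (c + q * y i)
      - (anti k g).eval (c + q * y' i)) := by
    have : ∑ i, σ i * ((anti k g).eval (c + q * y i) - (anti k g).eval (c + q * y' i))
      = ∑ n ∈ range k, (g.coeff n * ((k.factorial / (n + 1) : ℕ) : ℤ)) *
        (∑ i, σ i * (c + q * y i) ^ (n + 1) - ∑ i, σ i * (c + q * y' i) ^ (n + 1)) := by
      simp only [anti_eval, ← sum_sub_distrib, mul_sum]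
      rw [sum_comm]
      refine sum_congr rfl fun n _ => sum_congr rfl fun i _ => ?_
      ring
    rw [this]
    refine dvd_sum fun n hn => ?_
    by_cases hnd : n < d
    · have : g.coeff n = 0 := by
        rw [hg, coeff_X_pow_mul']; simp; omega
      simp [this]
    · exact Dvd.dvd.mul_left (hyp (n + 1) (by simp at hn ⊢; omega)) _
  have h2 : ∑ i, σ i * ((anti k g).eval (c + q * y i) - (anti k g).eval (c + q * y' i))
      = q ^ (l + 1) * ∑ i, σ i * (H.eval (y i) - H.eval (y' i)) := by
    rw [mul_sum]
    refine sum_congr rfl fun i _ => ?_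
    have e1 := key (y i)
    have e2 := key (y' i)
    linear_combination σ i * e1 - σ i * e2
  rw [h2] at h1
  have h3 : (p : ℤ) ^ (a * (l + 1)) * (p : ℤ) ^ M ∣
      (p : ℤ) ^ (a * (l + 1)) * ∑ i, σ i * (H.eval (y i) - H.eval (y' i)) := by
    rw [pow_mul (p : ℤ) a (l + 1)] 
    refine dvd_trans ?_ h1
    rw [← pow_mul, ← pow_add]
    apply pow_dvd_pow
    have : a * (l + 1) ≤ a * r := Nat.mul_le_mul_left _ hl
    rw [mul_comm r a]; omega
  exact (mul_dvd_mul_iff_left (pow_ne_zero _ hp0)).1 h3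

/-- Newton: equal power sums imply equal ranges. -/
lemma newton {F : Type*} [Field F] (r : ℕ) (hF : ∀ n : ℕ, 1 ≤ n → n ≤ r → (n : F) ≠ 0)
    (f g : Fin r → F) (h : ∀ l < r, ∑ i, f i ^ (l + 1) = ∑ i, g i ^ (l + 1)) (i : Fin r) :
    ∃ j, f i = g j := by
  have hes : ∀ n, n ≤ r → MvPolynomial.aeval f (MvPolynomial.esymm (Fin r) F n)
      = MvPolynomial.aeval g (MvPolynomial.esymm (Fin r) F n) := by
    intro n
    induction n using Nat.strong_induction_on with
    | _ n ih =>
      intro hn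
      rcases Nat.eq_zero_or_pos n with rfl | hpos
      · simp
      have e := MvPolynomial.mul_esymm_eq_sum (Fin r) F n
      have ef := congrArg (MvPolynomial.aeval f) e
      have eg := congrArg (MvPolynomial.aeval g) e
      simp only [map_mul, map_natCast, map_sum, map_pow, map_neg, map_one] at ef eg
      apply mul_left_cancel₀ (hF n hpos hn)
      rw [ef, eg]
      congr 1
      refine sum_congr rfl fun x hx => ?_
      simp only [mem_filter, HasAntidiagonal.mem_antidiagonal] at hx
      rw [ih x.1 hx.2 (by omega)]
      congr 1
      simp only [MvPolynomial.psum, map_sum, map_pow, MvPolynomial.aeval_X]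
      have := h (x.2 - 1) (by omega)
      rwa [show x.2 - 1 + 1 = x.2 by omega] at this
  have hprod : ∀ f : Fin r → F, ∏ j, (X - C (f j)) =
      ∑ j ∈ range (r + 1), (-1 : F[X]) ^ j * (C (MvPolynomial.aeval f (MvPolynomial.esymm (Fin r) F j)) * X ^ (r - j)) := by
    intro f
    have := Multiset.prod_X_sub_X_eq_sum_esymm (univ.val.map f)
    simp only [Multiset.map_map, Multiset.card_map, card_val, card_univ, Fintype.card_fin] at this
    simp only [MvPolynomial.aeval_esymm_eq_multiset_esymm]
    exact this
  have hfg : ∏ j, (X - C (f j)) = ∏ j, (X - C (g j)) := by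
    rw [hprod, hprod]
    refine sum_congr rfl fun j hj => ?_
    rw [hes j (by simp at hj; omega)]
  have := congrArg (eval (f i)) hfg
  rw [eval_prod, eval_prod, prod_eq_zero (mem_univ i) (by simp)] at this
  obtain ⟨j, _, hj⟩ := prod_eq_zero_iff.1 this.symm
  exact ⟨j, by simpa [sub_eq_zero] using hj⟩

lemma lemP_field {F : Type*} [Field F] (r : ℕ) (hF : ∀ n : ℕ, 1 ≤ n → n ≤ r → (n : F) ≠ 0)
    (σ : Fin r → ℤ) (hσ : ∀ i, σ i = 1 ∨ σ i = -1)
    (y y' : Fin r → F) (hy : Function.Injective y)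
    (h : ∀ l < r, ∑ i, (σ i : F) * (y i ^ (l + 1) - y' i ^ (l + 1)) = 0) :
    ∃ π : Fin r ↪ Fin r, ∀ i, y i = y' (π i) := by
  have hn : ∀ i, ∃ j, y i = y' j := by
    let f : Fin r → F := fun i => if σ i = 1 then y i else y' i
    let g : Fin r → F := fun i => if σ i = 1 then y' i else y i
    have hfg : ∀ l < r, ∑ i, f i ^ (l + 1) = ∑ i, g i ^ (l + 1) := by
      intro l hl
      rw [← sub_eq_zero, ← sum_sub_distrib, ← h l hl]
      refine sum_congr rfl fun i _ => ?_
      rcases hσ i with hi | hi <;> simp [f, g, hi]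
    intro i
    rcases hσ i with hi | hi
    · obtain ⟨j, hj⟩ := newton r hF f g hfg i
      rcases hσ j with hj1 | hj1
      · exact ⟨j, by simpa [f, g, hi, hj1] using hj⟩
      · have : y i = y j := by simpa [f, g, hi, hj1] using hj
        have := hy this
        subst this; omega
    · obtain ⟨j, hj⟩ := newton r hF g f (fun l hl => (hfg l hl).symm) i
      rcases hσ j with hj1 | hj1
      · have : y i = y j := by simpa [f, g, hi, hj1] using hj
        have := hy this
        subst this; omega
      · exact ⟨j, by simpa [f, g, hi, hj1] using hj⟩
  choose π hπ using hn
  exact ⟨⟨π, fun i j hij => hy (by rw [hπ i, hπ j, hij])⟩, hπ⟩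

lemma fact_ne {p k n : ℕ} (hp : p.Prime) (hkp : k < p) (hn : n ∣ k.factorial) :
    ((n : ℕ) : ZMod p) ≠ 0 := by
  rw [Ne, ZMod.natCast_eq_zero_iff]
  intro h
  exact absurd ((hp.dvd_factorial).1 (h.trans hn)) (by omega)

lemma cast_pow_dvd {p : ℕ} (M : ℕ) (hM : 1 ≤ M) {x : ℤ} (h : (p : ℤ) ^ M ∣ x) : (x : ZMod p) = 0 := by
  rw [ZMod.intCast_zmod_eq_zero_iff_dvd]
  exact (dvd_pow_self _ (by omega)).trans h

lemma lemP (p a M d r k : ℕ) (hp : p.Prime) (hk : k = d + r) (hkp : k < p) (ha : 1 ≤ a) (hM : 1 ≤ M)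
    (c : ℤ) (hc : ¬ (p : ℤ) ∣ c) (σ y y' : Fin r → ℤ) (hσ : ∀ i, σ i = 1 ∨ σ i = -1)
    (hy : ∀ i j, i ≠ j → ¬ (p : ℤ) ∣ y i - y j)
    (hyp : ∀ j ∈ Finset.Icc (d + 1) k, ((p : ℤ) ^ (M + r * a)) ∣
      ∑ i, σ i * (c + (p : ℤ) ^ a * y i) ^ j - ∑ i, σ i * (c + (p : ℤ) ^ a * y' i) ^ j) :
    ∃ π : Fin r ↪ Fin r, ∀ i, (p : ℤ) ∣ y i - y' (π i) := by
  have := Fact.mk hp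
  have hE := lemE p a M d r k hp hk c σ y y' hyp
  have hc' : (c : ZMod p) ≠ 0 := by rwa [Ne, ZMod.intCast_zmod_eq_zero_iff_dvd]
  obtain ⟨π, hπ⟩ := lemP_field (F := ZMod p) r
    (fun n h1 h2 => fact_ne (k := k) hp hkp (Nat.dvd_factorial h1 (by omega))) σ hσ
    (fun i => (y i : ZMod p)) (fun i => (y' i : ZMod p))
    (by
      intro i j hij
      by_contra hne
      apply hy i j hne
      rw [← ZMod.intCast_zmod_eq_zero_iff_dvd]
      push_cast
      exact sub_eq_zero.2 hij)
    (by
      intro l hl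
      have h0 := cast_pow_dvd M hM (hE l hl)
      have hev : ∀ u : ℤ, (((anti k (integrand c ((p : ℤ) ^ a) d l)).eval u : ℤ) : ZMod p)
          = ((c : ZMod p) ^ d * ((k.factorial / (l + 1) : ℕ) : ZMod p)) * (u : ZMod p) ^ (l + 1) := by
        intro u
        have e1 : (((anti k (integrand c ((p : ℤ) ^ a) d l)).eval u : ℤ) : ZMod p)
          = ((anti k (integrand c ((p : ℤ) ^ a) d l)).map (Int.castRingHom (ZMod p))).eval (u : ZMod p) := by
          simp
        rw [e1, anti_map]
        have e2 : (integrand c ((p : ℤ) ^ a) d l).map (Int.castRingHom (ZMod p)) = C ((c : ZMod p) ^ d) * X ^ l := by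
          have : a ≠ 0 := by omega
          simp [integrand, Polynomial.map_mul, Polynomial.map_pow, this]
        rw [e2, anti_monomial _ _ _ (by omega)]
      have hne : ((c : ZMod p) ^ d * ((k.factorial / (l + 1) : ℕ) : ZMod p)) ≠ 0 :=
        mul_ne_zero (pow_ne_zero _ hc') (fact_ne hp hkp
          (Nat.div_dvd_of_dvd (Nat.dvd_factorial (by omega) (by omega))))
      apply (mul_right_injective₀ hne)
      simp only [mul_zero]
      rw [← h0, mul_sum]
      push_cast
      refine sum_congr rfl fun i _ => ?_
      rw [hev, hev]; ring)
  refine ⟨π, fun i => ?_⟩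
  rw [← ZMod.intCast_zmod_eq_zero_iff_dvd]
  push_cast
  exact sub_eq_zero.2 (hπ i)

lemma lemU (p a M d r k : ℕ) (hp : p.Prime) (hk : k = d + r) (hkp : k < p) (ha : 1 ≤ a)
    (c : ℤ) (hc : ¬ (p : ℤ) ∣ c) (σ y y' : Fin r → ℤ) (hσ : ∀ i, σ i = 1 ∨ σ i = -1)
    (hy : ∀ i j, i ≠ j → ¬ (p : ℤ) ∣ y i - y j)
    (hyp : ∀ j ∈ Finset.Icc (d + 1) k, ((p : ℤ) ^ (M + r * a)) ∣
      ∑ i, σ i * (c + (p : ℤ) ^ a * y' i) ^ j - ∑ i, σ i * (c + (p : ℤ) ^ a * y i) ^ j)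
    (h1 : ∀ i, (p : ℤ) ∣ y' i - y i) :
    ∀ i, (p : ℤ) ^ M ∣ y' i - y i := by
  have := Fact.mk hp
  have hE := lemE p a M d r k hp hk c σ y' y hyp
  have hc' : (c : ZMod p) ≠ 0 := by rwa [Ne, ZMod.intCast_zmod_eq_zero_iff_dvd]
  have hp0 : (p : ℤ) ≠ 0 := by exact_mod_cast hp.ne_zero
  have main : ∀ s, s + 1 ≤ M → ∀ i, (p : ℤ) ^ (s + 1) ∣ y' i - y i := by
    intro s
    induction s with
    | zero => intro _ i; simpa using h1 i
    | succ s ih =>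
      intro hs
      choose e he using ih (by omega)
      have hv : ∀ l : Fin r, ∑ i, ((σ i : ZMod p) * (e i : ZMod p)) * ((y i : ℤ) : ZMod p) ^ (l : ℕ) = 0 := by
        intro l
        set H := anti k (integrand c ((p : ℤ) ^ a) d l) with hH
        have hHd : derivative H = C ((k.factorial : ℕ) : ℤ) * integrand c ((p : ℤ) ^ a) d l :=
          anti_derivative _ _ (lt_of_le_of_lt (integrand_deg _ _ d l) (by omega))
        have hx : ∀ i, ∃ t : ℤ, H.eval (y' i) - H.eval (y i)
            = (p : ℤ) ^ (s + 1) * ((derivative H).eval (y i) * e i + p * t) := by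
          intro i
          obtain ⟨t, ht⟩ := H.binomExpansion (y i) (y' i - y i)
          rw [he i, ← he i, add_sub_cancel, he i] at ht
          refine ⟨t * e i ^ 2 * (p : ℤ) ^ s, ?_⟩
          rw [ht]; ring
        choose t ht using hx
        have hd := hE l l.2
        simp only [← hH, ht] at hd
        have hd2 : (p : ℤ) ^ (s + 1) * (p : ℤ) ∣
            (p : ℤ) ^ (s + 1) * ∑ i, σ i * ((derivative H).eval (y i) * e i + p * t i) := by
          rw [← pow_succ]
          refine (pow_dvd_pow _ hs).trans (hd.trans (dvd_of_eq ?_))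
          rw [mul_sum]
          exact sum_congr rfl fun i _ => by ring
        have hd3 := (mul_dvd_mul_iff_left (pow_ne_zero _ hp0)).1 hd2
        rw [← ZMod.intCast_zmod_eq_zero_iff_dvd] at hd3
        have hne : ((k.factorial : ℕ) : ZMod p) * (c : ZMod p) ^ d ≠ 0 :=
          mul_ne_zero (fact_ne hp hkp dvd_rfl) (pow_ne_zero _ hc')
        apply mul_right_injective₀ hne
        simp only [mul_zero]
        rw [← hd3, mul_sum]
        push_cast
        refine sum_congr rfl fun i _ => ?_
        have ha0 : a ≠ 0 := by omega
        simp [hHd, integrand, ha0]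
        ring
      have hinj : Function.Injective (fun i => ((y i : ℤ) : ZMod p)) := by
        intro i j hij
        by_contra hne
        apply hy i j hne
        rw [← ZMod.intCast_zmod_eq_zero_iff_dvd]
        push_cast
        exact sub_eq_zero.2 hij
      have hz := Matrix.eq_zero_of_forall_pow_sum_mul_pow_eq_zero hinj hv
      intro i
      have hzi := congrFun hz i
      simp only [Pi.zero_apply, mul_eq_zero] at hzi
      have hei : ((e i : ℤ) : ZMod p) = 0 := by
        rcases hzi with h | h
        · exfalso
          rcases hσ i with h' | h' <;> simp [h'] at h
        · exact h
      rw [ZMod.intCast_zmod_eq_zero_iff_dvd] at hei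
      rw [he i, pow_succ]
      exact mul_dvd_mul_left _ hei
  intro i
  rcases Nat.eq_zero_or_pos M with rfl | hM
  · simp
  · have := main (M - 1) (by omega) i
    rwa [Nat.sub_add_cancel hM] at this

lemma ncard_image_le_of_code {α β T : Type*} [Fintype T] (S : Set α) (f : α → β) (F : α → T)
    (h : ∀ z ∈ S, ∀ z' ∈ S, F z = F z' → f z = f z') : (f '' S).ncard ≤ Fintype.card T := by
  classical
  rcases isEmpty_or_nonempty α with hα | hα
  · have : f '' S = ∅ := by
      rw [Set.image_eq_empty]; exact Set.eq_empty_of_isEmpty S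
    simp [this]
  have hg : ∀ b ∈ f '' S, ∃ x, x ∈ S ∧ f x = b := fun b hb => hb
  choose! g hg1 hg2 using hg
  rw [← Nat.card_eq_fintype_card, ← Set.ncard_univ]
  refine Set.ncard_le_ncard_of_injOn (fun b => F (g b)) (fun _ _ => Set.mem_univ _) ?_
  intro b hb b' hb' hbb
  rw [← hg2 b hb, ← hg2 b' hb']
  exact h _ (hg1 b hb) _ (hg1 b' hb') hbb

end Stmt11

theorem statement11 (k r : ℕ) (hk : 3 ≤ k) (hr1 : 1 ≤ r) (hr2 : r ≤ k - 1) :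
    ∃ p₀ : ℕ, ∀ p : ℕ, p.Prime → p₀ ≤ p →
      ∀ a b : ℕ, 1 ≤ a → a < b → (r - 1) * a ≤ b →
      ∀ ξ η : ℤ, 1 ≤ ξ → ξ ≤ (p : ℤ) ^ a → 1 ≤ η → η ≤ (p : ℤ) ^ b →
        ¬ ((p : ℤ) ∣ (η - ξ)) →
      ∀ σ : Fin r → ℤ, (∀ i, σ i = 1 ∨ σ i = -1) →
      ∀ m : ℕ → ℤ, (∀ j ∈ Finset.Icc 1 k, 1 ≤ m j ∧ m j ≤ (p : ℤ) ^ (k * b)) →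
      numClasses (p ^ ((k - r + 1) * b)) r (Bset p k r a b σ m ξ η) ≤
        k.factorial * p ^ ((r - 1) * a) := by
  classical
  refine ⟨k + 1, ?_⟩
  intro p hp hpk a b ha hab hrab ξ η _ _ _ _ hηξ σ hσ m _
  obtain ⟨d, hd⟩ : ∃ d, k = d + r := ⟨k - r, by omega⟩
  have hdr : k - r = d := by omega
  rw [hdr]
  set S := Bset p k r a b σ m ξ η with hS
  have hp0 : (p : ℤ) ≠ 0 := by exact_mod_cast hp.ne_zero
  set T := p ^ ((r - 1) * a) with hT
  have : NeZero T := ⟨pow_ne_zero _ hp.ne_zero⟩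
  have hab2 : a + 1 ≤ (d + 1) * b := by nlinarith
  obtain ⟨M, hM⟩ : ∃ M, (d + 1) * b = M + a := ⟨(d + 1) * b - a, by omega⟩
  have hM1 : 1 ≤ M := by omega
  have hN : (d + 1) * b + (r - 1) * a = M + r * a := by
    obtain ⟨r', rfl⟩ : ∃ r', r = r' + 1 := ⟨r - 1, by omega⟩
    simp only [Nat.add_sub_cancel]
    rw [hM]; ring
  have data : ∀ z ∈ S, ∃ y : Fin r → ℤ, ∃ t : ℤ, (∀ i, z i = ξ + (p : ℤ) ^ a * y i) ∧
      (∀ i j, i ≠ j → ¬ (p : ℤ) ∣ y i - y j) ∧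
      (∑ i, σ i * (z i - η) ^ (d + 1)) - m (d + 1) = (p : ℤ) ^ ((d + 1) * b) * t := by
    rintro z ⟨_, h2, ξ', ⟨h3, h4⟩, h5⟩
    have hz : ∀ i, (p : ℤ) ^ a ∣ z i - ξ := by
      intro i
      have e1 : (p : ℤ) ^ a ∣ z i - ξ' i := (pow_dvd_pow _ (Nat.le_succ a)).trans (h5 i)
      have := dvd_add e1 (h3 i).2.2
      simpa using this
    choose y hy using hz
    obtain ⟨t, ht⟩ := h2 (d + 1) (by simp; omega)
    refine ⟨y, t, fun i => by linarith [hy i], ?_, ht⟩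
    intro i j hij hdv
    apply h4 i j hij
    have e1 : (p : ℤ) ^ (a + 1) ∣ z i - z j := by
      have : z i - z j = (p : ℤ) ^ a * (y i - y j) := by linarith [hy i, hy j]
      rw [this, pow_succ]
      exact mul_dvd_mul_left _ hdv
    have := dvd_add (dvd_sub e1 (h5 i)) (h5 j)
    have e : z i - z j - (z i - ξ' i) + (z j - ξ' j) = ξ' i - ξ' j := by ring
    rwa [e] at this
  choose! y t hz hy ht using data
  let τ : (Fin r → ℤ) → ZMod T := fun z => (t z : ZMod T)
  have hyp : ∀ z ∈ S, ∀ z' ∈ S, τ z = τ z' → ∀ j ∈ Finset.Icc (d + 1) k,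
      ((p : ℤ) ^ (M + r * a)) ∣ ∑ i, σ i * ((ξ - η) + (p : ℤ) ^ a * y z i) ^ j
        - ∑ i, σ i * ((ξ - η) + (p : ℤ) ^ a * y z' i) ^ j := by
    intro z hzS z' hzS' hτ j hj
    rw [Finset.mem_Icc] at hj
    have e : ∀ w ∈ S, ∑ i, σ i * ((ξ - η) + (p : ℤ) ^ a * y w i) ^ j = ∑ i, σ i * (w i - η) ^ j := by
      intro w hw
      refine Finset.sum_congr rfl fun i _ => ?_
      rw [hz w hw i]; ring
    rw [e z hzS, e z' hzS', ← hN]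
    rcases Nat.eq_or_lt_of_le hj.1 with h | h
    · subst h
      have e2 : ∑ i, σ i * (z i - η) ^ (d + 1) - ∑ i, σ i * (z' i - η) ^ (d + 1)
        = (p : ℤ) ^ ((d + 1) * b) * (t z - t z') := by linarith [ht z hzS, ht z' hzS']
      rw [e2, pow_add]
      apply mul_dvd_mul_left
      have h3 : ((t z - t z' : ℤ) : ZMod T) = 0 := by
        push_cast; exact sub_eq_zero.2 hτ
      rw [ZMod.intCast_zmod_eq_zero_iff_dvd] at h3
      rw [hT] at h3
      exact_mod_cast h3
    · have hjm : j ∈ Finset.Icc 1 k := by rw [Finset.mem_Icc]; omega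
      have e3 := dvd_sub (hzS.2.1 j hjm) (hzS'.2.1 j hjm)
      rw [sub_sub_sub_cancel_right] at e3
      refine (pow_dvd_pow _ ?_).trans e3
      have : (d + 2) * b ≤ j * b := Nat.mul_le_mul_right _ h
      have e4 : (d + 2) * b = (d + 1) * b + b := by ring
      omega
  have hc : ¬ (p : ℤ) ∣ ξ - η := by
    rwa [← dvd_neg, neg_sub]
  have href : ∀ τ0 : ZMod T, ∃ w, ∀ z ∈ S, τ z = τ0 → w ∈ S ∧ τ w = τ0 := by
    intro τ0
    by_cases h : ∃ w ∈ S, τ w = τ0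
    · obtain ⟨w, hw1, hw2⟩ := h
      exact ⟨w, fun _ _ _ => ⟨hw1, hw2⟩⟩
    · exact ⟨0, fun z h1 h2 => absurd ⟨z, h1, h2⟩ h⟩
  choose ref href using href
  have : Nonempty (Fin r ↪ Fin r) := ⟨Function.Embedding.refl _⟩
  have hπ : ∀ z ∈ S, ∃ π : Fin r ↪ Fin r, ∀ i, (p : ℤ) ∣ y z i - y (ref (τ z)) (π i) := by
    intro z hzS
    obtain ⟨h1, h2⟩ := href (τ z) z hzS rfl
    exact Stmt11.lemP p a M d r k hp hd hpk ha hM1 (ξ - η) hc σ _ _ hσ (hy z hzS)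
      (hyp z hzS _ h1 h2.symm)
  choose! π hπ using hπ
  have hcount := Stmt11.ncard_image_le_of_code S
    (fun z : Fin r → ℤ => fun i => ((z i : ZMod (p ^ ((d + 1) * b))))) (fun z => (τ z, π z)) (by
      intro z hzS z' hzS' hF
      have hτ : τ z = τ z' := congrArg Prod.fst hF
      have hπ' : π z = π z' := congrArg Prod.snd hF
      have hU := Stmt11.lemU p a M d r k hp hd hpk ha (ξ - η) hc σ (y z') (y z) hσ (hy z' hzS')
        (hyp z hzS z' hzS' hτ) (by
          intro i
          have e1 := hπ z hzS i
          have e2 := hπ z' hzS' i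
          rw [hπ', hτ] at e1
          have := dvd_sub e1 e2
          rwa [sub_sub_sub_cancel_right] at this)
      funext i
      have h3 : ((z i - z' i : ℤ) : ZMod (p ^ ((d + 1) * b))) = 0 := by
        rw [ZMod.intCast_zmod_eq_zero_iff_dvd]
        push_cast
        have : z i - z' i = (y z i - y z' i) * (p : ℤ) ^ a := by
          rw [hz z hzS i, hz z' hzS' i]; ring
        rw [this, hM, pow_add]
        exact mul_dvd_mul_right (hU i) _
      push_cast at h3
      exact sub_eq_zero.1 h3)
  refine hcount.trans ?_
  rw [Fintype.card_prod, ZMod.card, Fintype.card_embedding_eq, Fintype.card_fin,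
    Nat.descFactorial_self, mul_comm]
  exact Nat.mul_le_mul_right _ (Nat.factorial_le (by omega))
end
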